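/- For ℓ = 1,…,L let W^{(ℓ)} ∈ ℝ^{C×C} and let P^{(ℓ)}_1,…,P^{(ℓ)}_C be N×N permutation matrices (which may be chosen depending on the input to layer ℓ). Set β = max_ℓ ‖W^{(ℓ)}‖₁. Then for every X ∈ ℝ^{N×C}, the output of the stacked CSP network satisfies r_{1,∞}(CSP_{W^{(L)}} ∘ ⋯ ∘ CSP_{W^{(1)}}(X)) ≤ C^{L/2} β^L · r_{1,∞}(X). -/

import Mathlib

open scoped BigOperators

/-- Maximum absolute column sum norm `‖X‖₁` of an `N × C` real matrix. -/
noncomputable def colNorm {N C : ℕ} (X : Matrix (Fin N) (Fin C) ℝ) : ℝ :=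
  ⨆ c : Fin C, ∑ n : Fin N, |X n c|

/-- Maximum absolute row sum norm `‖X‖_∞` of an `N × C` real matrix. -/
noncomputable def rowNorm {N C : ℕ} (X : Matrix (Fin N) (Fin C) ℝ) : ℝ :=
  ⨆ n : Fin N, ∑ c : Fin C, |X n c|

/-- Rank-one residual `r₁(X) = inf_x ‖X − 1_N x^⊤‖₁`. -/
noncomputable def r1 {N C : ℕ} (X : Matrix (Fin N) (Fin C) ℝ) : ℝ :=
  ⨅ x : Fin C → ℝ, colNorm (X - Matrix.of fun _ c => x c)

/-- Rank-one residual `r_∞(X) = inf_x ‖X − 1_N x^⊤‖_∞`. -/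
noncomputable def rInf {N C : ℕ} (X : Matrix (Fin N) (Fin C) ℝ) : ℝ :=
  ⨅ x : Fin C → ℝ, rowNorm (X - Matrix.of fun _ c => x c)

/-- `r_{1,∞}(X) = √(r₁(X) · r_∞(X))`. -/
noncomputable def r1Inf {N C : ℕ} (X : Matrix (Fin N) (Fin C) ℝ) : ℝ :=
  Real.sqrt (r1 X * rInf X)

/-- `P` is a permutation matrix. -/
def IsPermMatrix {N : ℕ} (P : Matrix (Fin N) (Fin N) ℝ) : Prop :=
  ∃ σ : Equiv.Perm (Fin N), ∀ i j, P i j = if i = σ j then 1 else 0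

/-- The CSP operator: the `c`-th column of `CSP P W X` is `P_c X w_c`,
where `w_c` is the `c`-th column of `W`. -/
noncomputable def CSP {N C : ℕ} (P : Fin C → Matrix (Fin N) (Fin N) ℝ)
    (W : Matrix (Fin C) (Fin C) ℝ) (X : Matrix (Fin N) (Fin C) ℝ) :
    Matrix (Fin N) (Fin C) ℝ :=
  Matrix.of fun n c => (P c).mulVec (X.mulVec fun r => W r c) n

section NormBounds

variable {N C : ℕ} (X : Matrix (Fin N) (Fin C) ℝ)

theorem colNorm_nonneg : 0 ≤ colNorm X :=
  Real.iSup_nonneg fun _ => Finset.sum_nonneg fun _ _ => abs_nonneg _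

theorem rowNorm_nonneg : 0 ≤ rowNorm X :=
  Real.iSup_nonneg fun _ => Finset.sum_nonneg fun _ _ => abs_nonneg _

theorem colSum_le_colNorm (c : Fin C) : ∑ n, |X n c| ≤ colNorm X :=
  le_ciSup (f := fun c => ∑ n, |X n c|) (Set.finite_range _).bddAbove c

theorem rowSum_le_rowNorm (n : Fin N) : ∑ c, |X n c| ≤ rowNorm X :=
  le_ciSup (f := fun n => ∑ c, |X n c|) (Set.finite_range _).bddAbove n

theorem abs_le_rowNorm (n : Fin N) (c : Fin C) : |X n c| ≤ rowNorm X :=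
  (Finset.single_le_sum (f := fun c => |X n c|) (fun _ _ => abs_nonneg _)
    (Finset.mem_univ c)).trans (rowSum_le_rowNorm X n)

theorem r1_nonneg : 0 ≤ r1 X :=
  Real.iInf_nonneg fun _ => colNorm_nonneg _

theorem rInf_nonneg : 0 ≤ rInf X :=
  Real.iInf_nonneg fun _ => rowNorm_nonneg _

theorem r1_le (x : Fin C → ℝ) : r1 X ≤ colNorm (X - Matrix.of fun _ c => x c) :=
  ciInf_le ⟨0, Set.forall_mem_range.2 fun _ => colNorm_nonneg _⟩ x

theorem rInf_le (x : Fin C → ℝ) : rInf X ≤ rowNorm (X - Matrix.of fun _ c => x c) :=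
  ciInf_le ⟨0, Set.forall_mem_range.2 fun _ => rowNorm_nonneg _⟩ x

end NormBounds

section Layer

variable {N C : ℕ} {P : Fin C → Matrix (Fin N) (Fin N) ℝ}

theorem IsPermMatrix.exists_mulVec_eq {P : Matrix (Fin N) (Fin N) ℝ} (hP : IsPermMatrix P) :
    ∃ σ : Equiv.Perm (Fin N), ∀ v n, P.mulVec v n = v (σ n) := by
  obtain ⟨σ, hσ⟩ := hP
  refine ⟨σ.symm, fun v n => ?_⟩
  simp [Matrix.mulVec, dotProduct, hσ, ← Equiv.symm_apply_eq]

theorem exists_perm_CSP_apply (hP : ∀ c, IsPermMatrix (P c)) :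
    ∃ σ : Fin C → Equiv.Perm (Fin N), ∀ (W : Matrix (Fin C) (Fin C) ℝ)
      (X : Matrix (Fin N) (Fin C) ℝ) n c, CSP P W X n c = ∑ r, X (σ c n) r * W r c := by
  choose σ hσ using fun c => (hP c).exists_mulVec_eq
  refine ⟨σ, fun W X n c => ?_⟩
  simp only [CSP, hσ, Matrix.of_apply]
  rfl

/-- Removing a constant row from the input removes a constant row from the output. -/
theorem CSP_sub_const (hP : ∀ c, IsPermMatrix (P c)) (W : Matrix (Fin C) (Fin C) ℝ)
    (X : Matrix (Fin N) (Fin C) ℝ) (x : Fin C → ℝ) :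
    CSP P W X - Matrix.of (fun _ c => ∑ r, x r * W r c) =
      CSP P W (X - Matrix.of fun _ c => x c) := by
  obtain ⟨σ, hσ⟩ := exists_perm_CSP_apply hP
  ext n c
  simp [hσ, sub_mul, Finset.sum_sub_distrib]

theorem colNorm_CSP_le (hP : ∀ c, IsPermMatrix (P c)) (W : Matrix (Fin C) (Fin C) ℝ)
    (X : Matrix (Fin N) (Fin C) ℝ) : colNorm (CSP P W X) ≤ colNorm W * colNorm X := by
  obtain ⟨σ, hσ⟩ := exists_perm_CSP_apply hP
  refine Real.iSup_le (fun c => ?_) (mul_nonneg (colNorm_nonneg W) (colNorm_nonneg X))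
  calc ∑ n, |CSP P W X n c| = ∑ n, |∑ r, X (σ c n) r * W r c| := by simp only [hσ]
    _ = ∑ n, |∑ r, X n r * W r c| := Equiv.sum_comp (σ c) fun n => |∑ r, X n r * W r c|
    _ ≤ ∑ n, ∑ r, |X n r| * |W r c| := by
        gcongr with n
        simpa only [abs_mul] using Finset.abs_sum_le_sum_abs (fun r => X n r * W r c) Finset.univ
    _ = ∑ r, |W r c| * ∑ n, |X n r| := by
        rw [Finset.sum_comm]
        simp only [Finset.mul_sum, mul_comm]
    _ ≤ ∑ r, |W r c| * colNorm X := by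
        gcongr with r
        exact colSum_le_colNorm X r
    _ = (∑ r, |W r c|) * colNorm X := (Finset.sum_mul ..).symm
    _ ≤ colNorm W * colNorm X :=
        mul_le_mul_of_nonneg_right (colSum_le_colNorm W c) (colNorm_nonneg X)

theorem rowNorm_CSP_le (hP : ∀ c, IsPermMatrix (P c)) (W : Matrix (Fin C) (Fin C) ℝ)
    (X : Matrix (Fin N) (Fin C) ℝ) : rowNorm (CSP P W X) ≤ C * colNorm W * rowNorm X := by
  obtain ⟨σ, hσ⟩ := exists_perm_CSP_apply hP
  have hX := rowNorm_nonneg X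
  have hW := colNorm_nonneg W
  refine Real.iSup_le (fun n => ?_) (by positivity)
  calc ∑ c, |CSP P W X n c| ≤ ∑ _c : Fin C, colNorm W * rowNorm X := by
        gcongr with c
        calc |CSP P W X n c| ≤ ∑ r, |X (σ c n) r| * |W r c| := by
              simpa only [hσ, abs_mul] using
                Finset.abs_sum_le_sum_abs (fun r => X (σ c n) r * W r c) Finset.univ
          _ ≤ ∑ r, rowNorm X * |W r c| := by
              gcongr with r
              exact abs_le_rowNorm X _ r
          _ = (∑ r, |W r c|) * rowNorm X := by rw [← Finset.mul_sum, mul_comm]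
          _ ≤ colNorm W * rowNorm X := mul_le_mul_of_nonneg_right (colSum_le_colNorm W c) hX
    _ = C * colNorm W * rowNorm X := by simp [mul_assoc]

theorem r1_CSP_le (hP : ∀ c, IsPermMatrix (P c)) (W : Matrix (Fin C) (Fin C) ℝ)
    (X : Matrix (Fin N) (Fin C) ℝ) : r1 (CSP P W X) ≤ colNorm W * r1 X := by
  rw [r1.eq_def X, Real.mul_iInf_of_nonneg (colNorm_nonneg W)]
  refine le_ciInf fun x => (r1_le _ fun c => ∑ r, x r * W r c).trans ?_
  rw [CSP_sub_const hP]
  exact colNorm_CSP_le hP W _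

theorem rInf_CSP_le (hP : ∀ c, IsPermMatrix (P c)) (W : Matrix (Fin C) (Fin C) ℝ)
    (X : Matrix (Fin N) (Fin C) ℝ) : rInf (CSP P W X) ≤ C * colNorm W * rInf X := by
  rw [rInf.eq_def X, Real.mul_iInf_of_nonneg (mul_nonneg C.cast_nonneg (colNorm_nonneg W))]
  refine le_ciInf fun x => (rInf_le _ fun c => ∑ r, x r * W r c).trans ?_
  rw [CSP_sub_const hP]
  exact rowNorm_CSP_le hP W _

theorem r1Inf_CSP_le (hP : ∀ c, IsPermMatrix (P c)) (W : Matrix (Fin C) (Fin C) ℝ)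
    (X : Matrix (Fin N) (Fin C) ℝ) :
    r1Inf (CSP P W X) ≤ Real.sqrt C * colNorm W * r1Inf X := by
  have hW := colNorm_nonneg W
  have h1 := r1_nonneg X
  calc r1Inf (CSP P W X)
      ≤ Real.sqrt ((colNorm W * r1 X) * (C * colNorm W * rInf X)) :=
        Real.sqrt_le_sqrt (mul_le_mul (r1_CSP_le hP W X) (rInf_CSP_le hP W X) (rInf_nonneg _)
          (by positivity))
    _ = Real.sqrt (C * colNorm W ^ 2 * (r1 X * rInf X)) := by ring_nf
    _ = Real.sqrt C * colNorm W * r1Inf X := by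
        rw [Real.sqrt_mul (by positivity), Real.sqrt_mul C.cast_nonneg, Real.sqrt_sq hW, r1Inf]

end Layer

/-- stacking `L` CSP layers yields
`r_{1,∞}(CSP_{W^{(L)}} ∘ ⋯ ∘ CSP_{W^{(1)}}(X)) ≤ C^{L/2} β^L r_{1,∞}(X)`
with `β = max_ℓ ‖W^{(ℓ)}‖₁`. -/
theorem stmt7 {N C L : ℕ}
    (W : Fin L → Matrix (Fin C) (Fin C) ℝ)
    (P : Fin L → Fin C → Matrix (Fin N) (Fin N) ℝ)
    (hP : ∀ ℓ c, IsPermMatrix (P ℓ c))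
    (beta : ℝ)
    (hbeta : beta = ⨆ ℓ : Fin L, colNorm (W ℓ))
    (X : Matrix (Fin N) (Fin C) ℝ)
    (Z : Fin (L + 1) → Matrix (Fin N) (Fin C) ℝ)
    (hZ0 : Z 0 = X)
    (hZsucc : ∀ ℓ : Fin L, Z ℓ.succ = CSP (P ℓ) (W ℓ) (Z ℓ.castSucc)) :
    r1Inf (Z (Fin.last L)) ≤ Real.sqrt (C : ℝ) ^ L * beta ^ L * r1Inf X := by
  have hbeta0 : 0 ≤ beta := hbeta ▸ Real.iSup_nonneg fun _ => colNorm_nonneg _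
  have hW (ℓ : Fin L) : colNorm (W ℓ) ≤ beta :=
    hbeta ▸ le_ciSup (f := fun ℓ => colNorm (W ℓ)) (Set.finite_range _).bddAbove ℓ
  have key (k : Fin (L + 1)) :
      r1Inf (Z k) ≤ (Real.sqrt (C : ℝ) * beta) ^ (k : ℕ) * r1Inf X := by
    induction k using Fin.induction with
    | zero => simp [hZ0]
    | succ ℓ ih =>
      have hr : 0 ≤ r1Inf (Z ℓ.castSucc) := Real.sqrt_nonneg _
      calc r1Inf (Z ℓ.succ)
          ≤ Real.sqrt C * colNorm (W ℓ) * r1Inf (Z ℓ.castSucc) := by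
            rw [hZsucc]
            exact r1Inf_CSP_le (hP ℓ) _ _
        _ ≤ Real.sqrt C * beta * r1Inf (Z ℓ.castSucc) := by
            gcongr
            exact hW ℓ
        _ ≤ Real.sqrt C * beta * ((Real.sqrt C * beta) ^ (ℓ : ℕ) * r1Inf X) := by
            gcongr
            exact ih
        _ = (Real.sqrt C * beta) ^ (ℓ.succ : ℕ) * r1Inf X := by
            rw [Fin.val_succ]
            ring
  simpa [mul_pow] using key (Fin.last L)
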